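/- Let L > 0 and let α, β, γ, δ, c, ε be real constants. Suppose u, w : ℝ × ℝ → ℝ are four times continuously differentiable, are 2L-periodic in the spatial variable x for every t, and satisfy the cRB system at every point. Define ū(t) = (1/2L)∫_{−L}^{L} u(x,t) dx and w̄(t) = (1/2L)∫_{−L}^{L} w(x,t) dx. Then the function t ↦ γ ū'(t) + δ w̄'(t) is constant on ℝ (conservation of the total mass flux; equivalently, when γ ≠ 0, d/dt(ū + (δ/γ)w̄) is constant in time). -/

import Mathlib

/-- Partial derivative in the first variable (space `x`). -/
noncomputable def pd1 (f : ℝ → ℝ → ℝ) (x y : ℝ) : ℝ := deriv (fun x' => f x' y) x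

/-- Partial derivative in the second variable (time `t`). -/
noncomputable def pd2 (f : ℝ → ℝ → ℝ) (x y : ℝ) : ℝ := deriv (fun y' => f x y') y

/-- The coupled regularised Boussinesq (cRB) system:
`u_tt − u_xx = ε[ (1/2)(u²)_xx + u_ttxx − δ(u − w) ]`,
`w_tt − c² w_xx = ε[ (α/2)(w²)_xx + β w_ttxx + γ(u − w) ]`. -/
def cRB (α β γ δ c ε : ℝ) (u w : ℝ → ℝ → ℝ) : Prop :=
  ∀ x t : ℝ,
    pd2 (pd2 u) x t - pd1 (pd1 u) x t
      = ε * ((1 / 2) * pd1 (pd1 (fun x t => (u x t) ^ 2)) x t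
          + pd1 (pd1 (pd2 (pd2 u))) x t - δ * (u x t - w x t)) ∧
    pd2 (pd2 w) x t - c ^ 2 * pd1 (pd1 w) x t
      = ε * ((α / 2) * pd1 (pd1 (fun x t => (w x t) ^ 2)) x t
          + β * pd1 (pd1 (pd2 (pd2 w))) x t + γ * (u x t - w x t))

open Function MeasureTheory

theorem hasDerivAt_pd1 {f : ℝ → ℝ → ℝ} (hf : Differentiable ℝ (uncurry f)) (x y : ℝ) :
    HasDerivAt (fun x' => f x' y) (pd1 f x y) x := by
  have h : DifferentiableAt ℝ (fun x' => uncurry f (x', y)) x :=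
    DifferentiableAt.comp (g := uncurry f) x (hf (x, y))
      (by fun_prop : DifferentiableAt ℝ (fun x' : ℝ => (x', y)) x)
  exact h.hasDerivAt

theorem hasDerivAt_pd2 {f : ℝ → ℝ → ℝ} (hf : Differentiable ℝ (uncurry f)) (x y : ℝ) :
    HasDerivAt (fun y' => f x y') (pd2 f x y) y := by
  have h : DifferentiableAt ℝ (fun y' => uncurry f (x, y')) y :=
    DifferentiableAt.comp (g := uncurry f) y (hf (x, y))
      (by fun_prop : DifferentiableAt ℝ (fun y' : ℝ => (x, y')) y)
  exact h.hasDerivAt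

theorem contDiff_uncurry_pd1 {m n : WithTop ℕ∞} {f : ℝ → ℝ → ℝ}
    (hf : ContDiff ℝ n (uncurry f)) (hmn : m + 1 ≤ n) : ContDiff ℝ m (uncurry (pd1 f)) := by
  have hd : Differentiable ℝ (uncurry f) :=
    (hf.of_le (le_add_self.trans hmn)).differentiable one_ne_zero
  have h : uncurry (pd1 f) = fun p => fderiv ℝ (uncurry f) p (1, 0) := by
    funext ⟨x, y⟩
    exact (((hd (x, y)).hasFDerivAt.comp_hasDerivAt x
      ((hasDerivAt_id x).prodMk (hasDerivAt_const x y))).deriv :)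
  rw [h]
  exact (hf.fderiv_right hmn).clm_apply contDiff_const

theorem contDiff_uncurry_pd2 {m n : WithTop ℕ∞} {f : ℝ → ℝ → ℝ}
    (hf : ContDiff ℝ n (uncurry f)) (hmn : m + 1 ≤ n) : ContDiff ℝ m (uncurry (pd2 f)) := by
  have hd : Differentiable ℝ (uncurry f) :=
    (hf.of_le (le_add_self.trans hmn)).differentiable one_ne_zero
  have h : uncurry (pd2 f) = fun p => fderiv ℝ (uncurry f) p (0, 1) := by
    funext ⟨x, y⟩
    exact (((hd (x, y)).hasFDerivAt.comp_hasDerivAt y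
      ((hasDerivAt_const y x).prodMk (hasDerivAt_id y))).deriv :)
  rw [h]
  exact (hf.fderiv_right hmn).clm_apply contDiff_const

theorem pd1_add_period {f : ℝ → ℝ → ℝ} {T : ℝ} (hf : ∀ x t, f (x + T) t = f x t) (x t : ℝ) :
    pd1 f (x + T) t = pd1 f x t := by
  simp only [pd1, ← deriv_comp_add_const, hf]

theorem pd2_add_period {f : ℝ → ℝ → ℝ} {T : ℝ} (hf : ∀ x t, f (x + T) t = f x t) (x t : ℝ) :
    pd2 f (x + T) t = pd2 f x t := by
  simp only [pd2, hf]

theorem Continuous.intervalIntegrable_left {f : ℝ → ℝ → ℝ} (hf : Continuous (uncurry f))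
    (t a b : ℝ) : IntervalIntegrable (fun x => f x t) volume a b :=
  Continuous.intervalIntegrable
    (hf.comp (by fun_prop : Continuous fun x : ℝ => (x, t))) a b

/-- The integral over a period of the second space derivative of a periodic function vanishes. -/
theorem integral_pd1_pd1_eq_zero {f : ℝ → ℝ → ℝ} {L : ℝ} (hf : ContDiff ℝ 2 (uncurry f))
    (hp : ∀ x t, f (x + 2 * L) t = f x t) (t : ℝ) :
    ∫ x in (-L)..L, pd1 (pd1 f) x t = 0 := by
  have h1 : ContDiff ℝ 1 (uncurry (pd1 f)) := contDiff_uncurry_pd1 hf (by norm_num)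
  have h2 : ContDiff ℝ 0 (uncurry (pd1 (pd1 f))) := contDiff_uncurry_pd1 h1 (by norm_num)
  rw [intervalIntegral.integral_eq_sub_of_hasDerivAt
    (fun x _ => hasDerivAt_pd1 (h1.differentiable one_ne_zero) x t)
    (h2.continuous.intervalIntegrable_left t _ _), sub_eq_zero,
    ← pd1_add_period hp (-L) t]
  congr 1
  ring

/-- Differentiation under the integral sign for a continuously differentiable integrand. -/
theorem hasDerivAt_integral_pd2 {f : ℝ → ℝ → ℝ} (hf : ContDiff ℝ 1 (uncurry f)) (a b t : ℝ) :
    HasDerivAt (fun s => ∫ x in a..b, f x s) (∫ x in a..b, pd2 f x t) t := by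
  have h2 : Continuous (uncurry (pd2 f)) :=
    (contDiff_uncurry_pd2 (m := 0) hf (by norm_num)).continuous
  obtain ⟨C, hC⟩ := (isCompact_uIcc.prod (isCompact_closedBall t 1)).exists_bound_of_continuousOn
    (s := Set.uIcc a b ×ˢ Metric.closedBall t 1) h2.continuousOn
  refine (intervalIntegral.hasDerivAt_integral_of_dominated_loc_of_deriv_le
    (F := fun s x => f x s) (F' := fun s x => pd2 f x s) (bound := fun _ => C)
    (Metric.closedBall_mem_nhds t one_pos) (.of_forall fun s => ?_)
    (hf.continuous.intervalIntegrable_left t a b) ?_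
    (.of_forall fun x hx s hs => hC (x, s) ⟨Set.uIoc_subset_uIcc hx, hs⟩)
    intervalIntegrable_const
    (.of_forall fun x _ s _ => hasDerivAt_pd2 (hf.differentiable one_ne_zero) x s)).2
  · exact (hf.continuous.intervalIntegrable_left s a b).def'.aestronglyMeasurable
  · exact (h2.intervalIntegrable_left t a b).def'.aestronglyMeasurable

/-- The integral over a period of `γ u_tt + δ w_tt` vanishes for solutions of the cRB system. -/
theorem cRB.integral_pd2_pd2_eq_zero {L α β γ δ c ε : ℝ} {u w : ℝ → ℝ → ℝ}
    (hsys : cRB α β γ δ c ε u w)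
    (hu : ContDiff ℝ 4 (uncurry u)) (hw : ContDiff ℝ 4 (uncurry w))
    (hup : ∀ x t, u (x + 2 * L) t = u x t) (hwp : ∀ x t, w (x + 2 * L) t = w x t) (t : ℝ) :
    γ * (∫ x in (-L)..L, pd2 (pd2 u) x t) + δ * (∫ x in (-L)..L, pd2 (pd2 w) x t) = 0 := by
  have tt {f : ℝ → ℝ → ℝ} (hf : ContDiff ℝ 4 (uncurry f)) : ContDiff ℝ 2 (uncurry (pd2 (pd2 f))) :=
    contDiff_uncurry_pd2 (contDiff_uncurry_pd2 (m := 3) hf (by norm_num)) (by norm_num)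
  have sq {f : ℝ → ℝ → ℝ} (hf : ContDiff ℝ 4 (uncurry f)) :
      ContDiff ℝ 2 (uncurry fun x t => f x t ^ 2) := (hf.pow 2).of_le (by norm_num)
  have xx {f : ℝ → ℝ → ℝ} (hf : ContDiff ℝ 2 (uncurry f)) :
      IntervalIntegrable (fun x => pd1 (pd1 f) x t) volume (-L) L :=
    (contDiff_uncurry_pd1 (m := 0) (contDiff_uncurry_pd1 (m := 1) hf (by norm_num))
      (by norm_num)).continuous.intervalIntegrable_left t _ _
  have hu2 : ContDiff ℝ 2 (uncurry u) := hu.of_le (by norm_num)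
  have hw2 : ContDiff ℝ 2 (uncurry w) := hw.of_le (by norm_num)
  have key (x : ℝ) : γ * pd2 (pd2 u) x t + δ * pd2 (pd2 w) x t =
      γ * pd1 (pd1 u) x t + γ * ε / 2 * pd1 (pd1 fun x t => u x t ^ 2) x t
        + γ * ε * pd1 (pd1 (pd2 (pd2 u))) x t + δ * c ^ 2 * pd1 (pd1 w) x t
        + δ * ε * α / 2 * pd1 (pd1 fun x t => w x t ^ 2) x t
        + δ * ε * β * pd1 (pd1 (pd2 (pd2 w))) x t := by
    linear_combination γ * (hsys x t).1 + δ * (hsys x t).2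
  have i1 := (xx hu2).const_mul γ
  have i2 := (xx (sq hu)).const_mul (γ * ε / 2)
  have i3 := (xx (tt hu)).const_mul (γ * ε)
  have i4 := (xx hw2).const_mul (δ * c ^ 2)
  have i5 := (xx (sq hw)).const_mul (δ * ε * α / 2)
  have i6 := (xx (tt hw)).const_mul (δ * ε * β)
  rw [← intervalIntegral.integral_const_mul, ← intervalIntegral.integral_const_mul,
    ← intervalIntegral.integral_add
      (((tt hu).continuous.intervalIntegrable_left t _ _).const_mul γ)
      (((tt hw).continuous.intervalIntegrable_left t _ _).const_mul δ)]
  simp only [key]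
  rw [intervalIntegral.integral_add ((((i1.add i2).add i3).add i4).add i5) i6,
    intervalIntegral.integral_add (((i1.add i2).add i3).add i4) i5,
    intervalIntegral.integral_add ((i1.add i2).add i3) i4,
    intervalIntegral.integral_add (i1.add i2) i3, intervalIntegral.integral_add i1 i2]
  simp only [intervalIntegral.integral_const_mul]
  rw [integral_pd1_pd1_eq_zero hu2 hup, integral_pd1_pd1_eq_zero hw2 hwp,
    integral_pd1_pd1_eq_zero (tt hu) (pd2_add_period (pd2_add_period hup)),
    integral_pd1_pd1_eq_zero (tt hw) (pd2_add_period (pd2_add_period hwp)),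
    integral_pd1_pd1_eq_zero (sq hu) (fun x t => by rw [hup]),
    integral_pd1_pd1_eq_zero (sq hw) (fun x t => by rw [hwp])]
  ring

/-- For `2L`-periodic (in `x`) C⁴ solutions of the cRB system, the combination
`γ ū'(t) + δ w̄'(t)` of the derivatives of the mean values is constant in time. -/
theorem stmt3 (L α β γ δ c ε : ℝ) (hL : 0 < L) (u w : ℝ → ℝ → ℝ)
    (hu : ContDiff ℝ 4 (Function.uncurry u)) (hw : ContDiff ℝ 4 (Function.uncurry w))
    (hup : ∀ x t, u (x + 2 * L) t = u x t) (hwp : ∀ x t, w (x + 2 * L) t = w x t)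
    (hsys : cRB α β γ δ c ε u w)
    (ubar wbar : ℝ → ℝ)
    (hub : ∀ t, ubar t = (1 / (2 * L)) * ∫ x in (-L)..L, u x t)
    (hwb : ∀ t, wbar t = (1 / (2 * L)) * ∫ x in (-L)..L, w x t) :
    ∀ s t : ℝ, γ * deriv ubar s + δ * deriv wbar s = γ * deriv ubar t + δ * deriv wbar t := by
  have dbar {f : ℝ → ℝ → ℝ} {fbar : ℝ → ℝ} (hf : ContDiff ℝ 4 (Function.uncurry f))
      (hfb : ∀ t, fbar t = (1 / (2 * L)) * ∫ x in (-L)..L, f x t) :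
      deriv fbar = fun t => (1 / (2 * L)) * ∫ x in (-L)..L, pd2 f x t := by
    funext t
    rw [funext hfb]
    exact ((hasDerivAt_integral_pd2 (hf.of_le (by norm_num)) (-L) L t).const_mul _).deriv
  have ddbar {f : ℝ → ℝ → ℝ} (hf : ContDiff ℝ 4 (Function.uncurry f)) (t : ℝ) :=
    (hasDerivAt_integral_pd2 (contDiff_uncurry_pd2 (m := 1) hf (by norm_num)) (-L) L
      t).const_mul (1 / (2 * L))
  rw [dbar hu hub, dbar hw hwb]
  have hconst (t : ℝ) := ((ddbar hu t).const_mul γ).fun_add ((ddbar hw t).const_mul δ)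
  refine is_const_of_deriv_eq_zero (fun t => (hconst t).differentiableAt) fun t => ?_
  rw [(hconst t).deriv]
  linear_combination (1 / (2 * L)) * hsys.integral_pd2_pd2_eq_zero hu hw hup hwp t
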